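/- arXiv:2109.00908 — 6 statements merged into one kernel-verified Lean document; each statement's English description precedes it below -/
import Mathlib

section
/- Let R be a commutative ring, n a positive integer, and let λ ∈ R be a unit with λ² = 1. If A = circ_λ(a) is the λ-circulant matrix generated by a ∈ Rⁿ, then the matrix A Aᵀ is λ-circulant. -/
open Matrix

/-- The `λ`-circulant matrix generated by the vector `a`. -/
def lamCirc {R : Type*} [CommRing R] {n : ℕ} (l : R) (a : Fin n → R) :
    Matrix (Fin n) (Fin n) R :=
  Matrix.of fun i j => if (i : ℕ) ≤ (j : ℕ) then a (j - i) else l * a (j - i)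

/-- The wrap-around factors of the entries of a `λ`-circulant matrix satisfy a cocycle identity
as soon as `λ² = 1`. -/
theorem lamCirc_wrap_mul_wrap {R : Type*} [CommRing R] {n : ℕ} {l : R} (hl : l ^ 2 = 1)
    (i j t : Fin n) :
    (if (i : ℕ) ≤ ((t + i : Fin n) : ℕ) then (1 : R) else l) *
        (if (j : ℕ) ≤ ((t + i : Fin n) : ℕ) then 1 else l) =
      (if (i : ℕ) ≤ (j : ℕ) then 1 else l) *
        (if ((j - i : Fin n) : ℕ) ≤ (t : ℕ) then 1 else l) := by
  have hadd : ((t + i : Fin n) : ℕ) = if n ≤ t + i then (t + i - n : ℕ) else t + i :=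
    Fin.val_add_eq_ite t i
  have hsub : ((j - i : Fin n) : ℕ) = if (i : ℕ) ≤ j then (j - i : ℕ) else n + j - i := by
    split_ifs with h
    · exact Fin.coe_sub_iff_le.2 h
    · exact Fin.coe_sub_iff_lt.2 (not_le.1 h)
  rw [hadd, hsub]
  have := i.isLt
  have := j.isLt
  have := t.isLt
  have hmul : l * l = 1 := by rw [← sq, hl]
  split_ifs <;> first | omega | simp [hmul]

theorem lamCirc_apply {R : Type*} [CommRing R] {n : ℕ} (l : R) (a : Fin n → R) (i j : Fin n) :
    lamCirc l a i j = (if (i : ℕ) ≤ (j : ℕ) then 1 else l) * a (j - i) := by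
  simp [lamCirc, ite_mul]

/-- If `λ` is a unit with `λ² = 1` and `A` is `λ`-circulant, then `A * Aᵀ` is
`λ`-circulant. -/
theorem lamCirc_mul_transpose_self {R : Type*} [CommRing R] {n : ℕ} (hn : 0 < n)
    (l : R) (hu : IsUnit l) (hl : l ^ 2 = 1) (a : Fin n → R) :
    ∃ c : Fin n → R, lamCirc l a * (lamCirc l a)ᵀ = lamCirc l c := by
  have : NeZero n := ⟨hn.ne'⟩
  refine ⟨fun x => ∑ t, a t * lamCirc l a x t, ?_⟩
  ext i j
  rw [Matrix.mul_apply, lamCirc_apply, Finset.mul_sum, ← Equiv.sum_comp (Equiv.addRight i)]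
  refine Finset.sum_congr rfl fun t _ => ?_
  simp only [Matrix.transpose_apply, lamCirc_apply, Equiv.coe_addRight, add_sub_cancel_right]
  rw [show t - (j - i) = t + i - j by abel]
  linear_combination a t * a (t + i - j) * lamCirc_wrap_mul_wrap hl i j t
end

section
/- Let R = 𝔽₂[u]/(u²) (the ring 𝔽₂ + u𝔽₂ with u² = 0) and let φ : Rⁿ → 𝔽₂^{2n} be the Gray map sending a + bu (with a, b ∈ 𝔽₂ⁿ) to the concatenated vector (b, a + b). If x, y ∈ Rⁿ satisfy ⟨x, y⟩ = 0 in R (Euclidean inner product ⟨x,y⟩ = Σᵢ xᵢyᵢ), then ⟨φ(x), φ(y)⟩ = 0 in 𝔽₂. -/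
/-- The Gray map `φ : (𝔽₂ + u𝔽₂)ⁿ → 𝔽₂^{2n}`, sending `a + bu` (componentwise,
with `a, b ∈ 𝔽₂ⁿ`) to the concatenated vector `(b, a + b)`.  Here `𝔽₂ + u𝔽₂`
(the ring `𝔽₂[u]/(u²)`) is realised as `DualNumber (ZMod 2)`, and `𝔽₂^{2n}` is
indexed by `Fin n ⊕ Fin n`. -/
def grayMap {n : ℕ} (x : Fin n → DualNumber (ZMod 2)) : Fin n ⊕ Fin n → ZMod 2 :=
  Sum.elim (fun i => (x i).snd) (fun i => (x i).fst + (x i).snd)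

/-- The Gray map preserves orthogonality: if `⟨x, y⟩ = 0` in `𝔽₂ + u𝔽₂`, then
`⟨φ(x), φ(y)⟩ = 0` in `𝔽₂`. -/
theorem grayMap_orthogonal {n : ℕ} (x y : Fin n → DualNumber (ZMod 2))
    (h : ∑ i, x i * y i = 0) :
    ∑ i : Fin n ⊕ Fin n, grayMap x i * grayMap y i = 0 := by
  have hfst : ∑ i, (x i * y i).fst = 0 := by
    simpa only [TrivSqZeroExt.fst_sum, TrivSqZeroExt.fst_zero] using
      congrArg TrivSqZeroExt.fst h
  have hsnd : ∑ i, (x i * y i).snd = 0 := by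
    simpa only [TrivSqZeroExt.snd_sum, TrivSqZeroExt.snd_zero] using
      congrArg TrivSqZeroExt.snd h
  rw [Fintype.sum_sum_type, ← Finset.sum_add_distrib]
  calc
    _ = ∑ i, ((x i * y i).fst + (x i * y i).snd) := by
      refine Finset.sum_congr rfl fun i _ => ?_
      simp only [grayMap, Sum.elim_inl, Sum.elim_inr, TrivSqZeroExt.fst_mul,
        DualNumber.snd_mul]
      linear_combination CharTwo.add_self_eq_zero ((x i).snd * (y i).snd)
    _ = 0 := by rw [Finset.sum_add_distrib, hfst, hsnd, add_zero]
end

section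
/- Let R = 𝔽₂[u]/(u²) and let φ : Rⁿ → 𝔽₂^{2n} be the Gray map sending a + bu (a, b ∈ 𝔽₂ⁿ) to (b, a+b). If C ⊆ Rⁿ is a self-orthogonal linear code (i.e., C is an R-submodule of Rⁿ with C ⊆ C^⊥, where C^⊥ = {x ∈ Rⁿ : ⟨x, y⟩ = 0 for all y ∈ C}), then φ(C) is a self-orthogonal binary linear code of length 2n, i.e., φ(C) is an 𝔽₂-subspace of 𝔽₂^{2n} with φ(C) ⊆ φ(C)^⊥. -/
theorem grayMap_add {n : ℕ} (x y : Fin n → DualNumber (ZMod 2)) :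
    grayMap (x + y) = grayMap x + grayMap y := by
  ext (i | i)
  · simp [grayMap]
  · simp only [grayMap, Pi.add_apply, Sum.elim_inr, TrivSqZeroExt.fst_add, TrivSqZeroExt.snd_add]
    ring

theorem grayMap_inl_smul {n : ℕ} (c : ZMod 2) (x : Fin n → DualNumber (ZMod 2)) :
    grayMap ((TrivSqZeroExt.inl c : DualNumber (ZMod 2)) • x) = c • grayMap x := by
  ext (i | i) <;> simp [grayMap, mul_add]

/-- The inner product of two Gray images is the sum of the two components of the inner product
over `𝔽₂ + u𝔽₂`. -/
theorem sum_grayMap_mul_grayMap {n : ℕ} (x y : Fin n → DualNumber (ZMod 2)) :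
    ∑ i, grayMap x i * grayMap y i = (∑ i, x i * y i).fst + (∑ i, x i * y i).snd := by
  have two_eq_zero : (2 : ZMod 2) = 0 := rfl
  rw [TrivSqZeroExt.fst_sum, TrivSqZeroExt.snd_sum, Fintype.sum_sum_type,
    ← Finset.sum_add_distrib, ← Finset.sum_add_distrib]
  refine Finset.sum_congr rfl fun i _ => ?_
  simp only [grayMap, Sum.elim_inl, Sum.elim_inr, TrivSqZeroExt.fst_mul, TrivSqZeroExt.snd_mul,
    smul_eq_mul, MulOpposite.smul_eq_mul_unop, MulOpposite.unop_op]
  linear_combination (x i).snd * (y i).snd * two_eq_zero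

/-- If `C` is a self-orthogonal linear code of length `n` over `𝔽₂ + u𝔽₂`, then its
Gray image `φ(C)` is a self-orthogonal binary linear code of length `2n`: it is an
`𝔽₂`-subspace of `𝔽₂^{2n}` all of whose pairs of elements are orthogonal. -/
theorem grayMap_image_self_orthogonal {n : ℕ}
    (C : Submodule (DualNumber (ZMod 2)) (Fin n → DualNumber (ZMod 2)))
    (hC : ∀ x ∈ C, ∀ y ∈ C, ∑ i, x i * y i = 0) :
    ∃ D : Submodule (ZMod 2) (Fin n ⊕ Fin n → ZMod 2),
      (D : Set (Fin n ⊕ Fin n → ZMod 2)) = grayMap '' (C : Set (Fin n → DualNumber (ZMod 2))) ∧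
      ∀ x ∈ D, ∀ y ∈ D, ∑ i, x i * y i = 0 := by
  refine ⟨{ carrier := grayMap '' (C : Set (Fin n → DualNumber (ZMod 2)))
            add_mem' := ?_
            zero_mem' := ⟨0, C.zero_mem, ?_⟩
            smul_mem' := ?_ }, rfl, ?_⟩
  · rintro _ _ ⟨x, hx, rfl⟩ ⟨y, hy, rfl⟩
    exact ⟨x + y, C.add_mem hx hy, grayMap_add x y⟩
  · ext (i | i) <;> simp [grayMap]
  · rintro c _ ⟨x, hx, rfl⟩
    exact ⟨_, C.smul_mem _ hx, grayMap_inl_smul c x⟩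
  · rintro _ ⟨x, hx, rfl⟩ _ ⟨y, hy, rfl⟩
    rw [sum_grayMap_mul_grayMap, hC x hx y hy]
    simp
end

section
/- Let R = 𝔽₂[u]/(u²) and let φ : Rⁿ → 𝔽₂^{2n} be the Gray map sending a + bu (a, b ∈ 𝔽₂ⁿ) to (b, a+b). If C ⊆ Rⁿ is a self-dual linear code of length n over R (an R-submodule with C = C^⊥), then φ(C) is a binary self-dual code of length 2n: φ(C) is an 𝔽₂-subspace of 𝔽₂^{2n} with φ(C) = φ(C)^⊥, and in particular dim_{𝔽₂} φ(C) = n. -/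
/-- The Gray map as an `𝔽₂`-linear equivalence. -/
def grayEquiv (n : ℕ) :
    (Fin n → DualNumber (ZMod 2)) ≃ₗ[ZMod 2] (Fin n ⊕ Fin n → ZMod 2) where
  toFun := grayMap
  invFun v i := (v (Sum.inr i) - v (Sum.inl i), v (Sum.inl i))
  map_add' x y := by
    ext (i | i) <;> simp [grayMap]
    ring
  map_smul' c x := by
    ext (i | i) <;> simp [grayMap]
    ring
  left_inv x := by
    ext i
    · exact add_sub_cancel_right _ _
    · rfl
  right_inv v := by
    ext (i | i)
    · rfl
    · exact sub_add_cancel _ _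

/-- A vector is orthogonal to a linear code over `𝔽₂ + u𝔽₂` exactly when its Gray image is
orthogonal to the Gray image of the code. -/
theorem forall_sum_grayMap_eq_zero_iff {n : ℕ}
    (C : Submodule (DualNumber (ZMod 2)) (Fin n → DualNumber (ZMod 2)))
    (x : Fin n → DualNumber (ZMod 2)) :
    (∀ y ∈ C, ∑ i, grayMap x i * grayMap y i = 0) ↔ ∀ y ∈ C, ∑ i, x i * y i = 0 := by
  refine ⟨fun h y hy => ?_, fun h y hy => by simp only [sum_grayMap_mul_grayMap, h y hy, TrivSqZeroExt.fst_zero,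
    TrivSqZeroExt.snd_zero, add_zero]⟩
  have h₁ := h y hy
  have h₂ := h _ (C.smul_mem DualNumber.eps hy)
  have heps : ∑ i, x i * ((DualNumber.eps : DualNumber (ZMod 2)) • y) i =
      DualNumber.eps * ∑ i, x i * y i := by
    rw [Finset.mul_sum]
    exact Finset.sum_congr rfl fun i _ => by simp [mul_left_comm]
  rw [sum_grayMap_mul_grayMap] at h₁ h₂
  rw [heps] at h₂
  have hfst : (∑ i, x i * y i).fst = 0 := by simpa [DualNumber.snd_mul] using h₂
  rw [hfst, zero_add] at h₁
  exact TrivSqZeroExt.ext hfst h₁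

/-- Twice the dimension of a self-dual code over a field is its length. -/
theorem two_mul_finrank_of_self_dual {K ι : Type*} [Field K] [Fintype ι]
    (D : Submodule K (ι → K)) (hD : ∀ x, x ∈ D ↔ ∀ y ∈ D, ∑ i, x i * y i = 0) :
    2 * Module.finrank K D = Fintype.card ι := by
  classical
  have hdual : D.dualAnnihilator.comap (dotProductEquiv K ι).toLinearMap = D := by
    ext x
    rw [hD x]
    simp [Submodule.mem_dualAnnihilator, dotProduct]
  have hrank : Module.finrank K D.dualAnnihilator = Module.finrank K D := by
    conv_rhs => rw [← hdual]
    rw [Submodule.comap_equiv_eq_map_symm]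
    exact (LinearEquiv.finrank_map_eq _ _).symm
  have hsum := Subspace.finrank_add_finrank_dualAnnihilator_eq D
  rw [hrank, Module.finrank_fintype_fun_eq_card] at hsum
  lia

/-- If `C` is a self-dual linear code of length `n` over `𝔽₂ + u𝔽₂` (i.e. `C = C^⊥`),
then its Gray image `φ(C)` is a binary self-dual code of length `2n`: it is an
`𝔽₂`-subspace of `𝔽₂^{2n}` equal to its own dual, and has dimension `n` over `𝔽₂`. -/
theorem grayMap_image_self_dual {n : ℕ}
    (C : Submodule (DualNumber (ZMod 2)) (Fin n → DualNumber (ZMod 2)))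
    (hC : ∀ x, x ∈ C ↔ ∀ y ∈ C, ∑ i, x i * y i = 0) :
    ∃ D : Submodule (ZMod 2) (Fin n ⊕ Fin n → ZMod 2),
      (D : Set (Fin n ⊕ Fin n → ZMod 2)) = grayMap '' (C : Set (Fin n → DualNumber (ZMod 2))) ∧
      (∀ x, x ∈ D ↔ ∀ y ∈ D, ∑ i, x i * y i = 0) ∧
      Module.finrank (ZMod 2) D = n := by
  let D := (C.restrictScalars (ZMod 2)).map (grayEquiv n).toLinearMap
  have hset : (D : Set (Fin n ⊕ Fin n → ZMod 2)) =
      grayMap '' (C : Set (Fin n → DualNumber (ZMod 2))) := rfl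
  have hD : ∀ x, x ∈ D ↔ ∀ y ∈ D, ∑ i, x i * y i = 0 := by
    intro v
    obtain ⟨x, rfl⟩ := (grayEquiv n).surjective v
    have hx : grayEquiv n x ∈ D ↔ x ∈ C := (grayEquiv n).injective.mem_set_image
    rw [hx, hC, ← forall_sum_grayMap_eq_zero_iff]
    exact (Set.forall_mem_image (f := grayMap) (s := (C : Set (Fin n → DualNumber (ZMod 2))))
      (p := fun w => ∑ i, grayMap x i * w i = 0)).symm
  have hdim := two_mul_finrank_of_self_dual D hD
  rw [Fintype.card_sum, Fintype.card_fin] at hdim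
  exact ⟨D, hset, hD, by lia⟩
end

section
/- Let K be a field of characteristic 2, let n ≥ 2, and let λ, μ ∈ K with λ² = μ² = 1. Let A = circ_λ(a), B = circ_λ(b), C = circ_μ(c) for a, b, c ∈ Kⁿ, let X = [[AC, B], [BᵀC, Aᵀ]], let ξ₁,…,ξ₆ ∈ K, let v = (v₁, v₂) ∈ K^{2n} with v₁ = (ξ₁,…,ξ₁,ξ₂) ∈ Kⁿ (ξ₁ repeated n−1 times) and v₂ = (ξ₃,…,ξ₃,ξ₄,ξ₄) ∈ Kⁿ (ξ₃ repeated n−2 times), and let G be the (2n+1)×(4n+2) matrix whose first row is (v, 0_{2n}, ξ₅, ξ₆) and whose remaining 2n rows form (I_{2n} | X | vᵀ vᵀ). Assume GGᵀ = 0. Then rank(G) = 2n+1 if and only if the vector (v₁A + v₂Bᵀ, v₁B + v₂Aᵀ, ξ₅, ξ₆) ∈ K^{2n+2} is nonzero (equivalently, has rank 1 as a 1×(2n+2) matrix). -/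
open Matrix

/-- The bordered `(2n+1) × (4n+2)` generator matrix
`G = [ v 0 ξ₅ ξ₆ ; I_{2n} X vᵀ vᵀ ]`. -/
def borderG {R : Type*} [CommRing R] {n : ℕ}
    (X : Matrix (Fin n ⊕ Fin n) (Fin n ⊕ Fin n) R) (v : Fin n ⊕ Fin n → R)
    (ξ₅ ξ₆ : R) :
    Matrix (Unit ⊕ (Fin n ⊕ Fin n)) ((Fin n ⊕ Fin n) ⊕ ((Fin n ⊕ Fin n) ⊕ Fin 2)) R :=
  Matrix.of fun r c =>
    match r, c with
    | Sum.inl _, Sum.inl j => v j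
    | Sum.inl _, Sum.inr (Sum.inl _) => 0
    | Sum.inl _, Sum.inr (Sum.inr k) => if k = 0 then ξ₅ else ξ₆
    | Sum.inr i, Sum.inl j => if i = j then 1 else 0
    | Sum.inr i, Sum.inr (Sum.inl j) => X i j
    | Sum.inr i, Sum.inr (Sum.inr _) => v i

theorem Matrix.rank_eq_card_iff_linearIndependent_row {R m n : Type*} [Field R] [Fintype m]
    [Fintype n] (M : Matrix m n R) :
    M.rank = Fintype.card m ↔ LinearIndependent R M.row := by
  rw [Matrix.rank_eq_finrank_span_row, linearIndependent_iff_card_eq_finrank_span, eq_comm,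
    Set.finrank]

/-- Orthogonality of the lower rows of `borderG` forces `X Xᵀ = -1` in characteristic two. -/
theorem mul_transpose_eq_neg_one_of_borderG {R : Type*} [CommRing R] (h2 : (2 : R) = 0) {n : ℕ}
    {X : Matrix (Fin n ⊕ Fin n) (Fin n ⊕ Fin n) R} {v : Fin n ⊕ Fin n → R} {ξ₅ ξ₆ : R}
    (h : borderG X v ξ₅ ξ₆ * (borderG X v ξ₅ ξ₆)ᵀ = 0) : X * Xᵀ = -1 := by
  ext i j
  have hij := congrFun (congrFun h (Sum.inr i)) (Sum.inr j)
  rw [Matrix.mul_apply, Fintype.sum_sum_type,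
    Fintype.sum_sum_type (fun k => _ * (borderG X v ξ₅ ξ₆)ᵀ (Sum.inr k) _),
    Fin.sum_univ_two] at hij
  simp only [borderG, transpose_apply, of_apply, Matrix.zero_apply, ite_mul, one_mul, zero_mul,
    Finset.sum_ite_eq, Finset.mem_univ, if_true] at hij
  rw [Matrix.mul_apply, Matrix.neg_apply, Matrix.one_apply]
  simp only [transpose_apply, eq_comm (a := j)] at hij ⊢
  linear_combination hij - v i * v j * h2

/-- The rows of `borderG` are independent unless the first one vanishes, when `X Xᵀ = -1`. -/
theorem linearIndependent_row_borderG_iff {K : Type*} [Field K] {n : ℕ}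
    {X : Matrix (Fin n ⊕ Fin n) (Fin n ⊕ Fin n) K} (v : Fin n ⊕ Fin n → K) (ξ₅ ξ₆ : K)
    (hX : ∀ y, y ᵥ* X = 0 → y = 0) :
    LinearIndependent K (borderG X v ξ₅ ξ₆).row ↔ ¬ (v = 0 ∧ ξ₅ = 0 ∧ ξ₆ = 0) := by
  constructor
  · rintro h ⟨rfl, rfl, rfl⟩
    refine h.ne_zero (Sum.inl ()) ?_
    ext (j | j | j) <;> simp [borderG, Matrix.row]
  · intro h
    rw [← Matrix.vecMul_injective_iff, ← Matrix.coe_vecMulLinear, ← LinearMap.ker_eq_bot,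
      LinearMap.ker_eq_bot']
    intro x hx
    rw [Matrix.vecMulLinear_apply] at hx
    have hy : (fun i => x (Sum.inr i)) = 0 := by
      apply hX
      ext j
      simpa [borderG, Matrix.vecMul, dotProduct] using congrFun hx (Sum.inr (Sum.inl j))
    have hy' (i) : x (Sum.inr i) = 0 := congrFun hy i
    have ht : x (Sum.inl ()) = 0 := by
      by_contra ht
      refine h ⟨funext fun j => ?_, ?_, ?_⟩
      · simpa [borderG, Matrix.vecMul, dotProduct, hy', ht] using congrFun hx (Sum.inl j)
      · simpa [borderG, Matrix.vecMul, dotProduct, hy', ht] using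
          congrFun hx (Sum.inr (Sum.inr 0))
      · simpa [borderG, Matrix.vecMul, dotProduct, hy', ht] using
          congrFun hx (Sum.inr (Sum.inr 1))
    ext (_ | i)
    · exact ht
    · exact hy' i

/-- Over a field `K` of characteristic 2, with the bordered matrix `G` as above
satisfying `G Gᵀ = 0`, the rank of `G` is `2n + 1` iff the vector
`(v₁ A + v₂ Bᵀ, v₁ B + v₂ Aᵀ, ξ₅, ξ₆) ∈ K^{2n+2}` is nonzero. -/
theorem borderG_rank_iff {K : Type*} [Field K] (h2 : (2 : K) = 0)
    {n : ℕ} (hn : 2 ≤ n) (l m : K) (hl : l ^ 2 = 1) (hm : m ^ 2 = 1)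
    (a b c : Fin n → K) (ξ₁ ξ₂ ξ₃ ξ₄ ξ₅ ξ₆ : K) :
    let A := lamCirc l a
    let B := lamCirc l b
    let C := lamCirc m c
    let X := Matrix.fromBlocks (A * C) B (Bᵀ * C) Aᵀ
    let v₁ : Fin n → K := fun i => if (i : ℕ) < n - 1 then ξ₁ else ξ₂
    let v₂ : Fin n → K := fun i => if (i : ℕ) < n - 2 then ξ₃ else ξ₄
    let G := borderG X (Sum.elim v₁ v₂) ξ₅ ξ₆
    let w : (Fin n ⊕ Fin n) ⊕ Fin 2 → K :=
      Sum.elim (Sum.elim (v₁ ᵥ* A + v₂ ᵥ* Bᵀ) (v₁ ᵥ* B + v₂ ᵥ* Aᵀ))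
        (fun k => if k = 0 then ξ₅ else ξ₆)
    G * Gᵀ = 0 → (G.rank = 2 * n + 1 ↔ w ≠ 0) := by
  intro A B C X v₁ v₂ G w hG
  have hXX : X * Xᵀ = -1 := mul_transpose_eq_neg_one_of_borderG h2 hG
  have hX (y) (hy : y ᵥ* X = 0) : y = 0 := by
    have := congrArg (· ᵥ* Xᵀ) hy
    simpa [Matrix.vecMul_vecMul, hXX, Matrix.vecMul_neg] using this
  have hcard : Fintype.card (Unit ⊕ (Fin n ⊕ Fin n)) = 2 * n + 1 := by
    simp only [Fintype.card_sum, Fintype.card_fin, Fintype.card_unit]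
    ring
  rw [← hcard, Matrix.rank_eq_card_iff_linearIndependent_row,
    linearIndependent_row_borderG_iff _ _ _ hX, ne_eq, not_iff_not]
  constructor
  · rintro ⟨hv, h5, h6⟩
    have hv₁ : v₁ = 0 := funext fun i => congrFun hv (Sum.inl i)
    have hv₂ : v₂ = 0 := funext fun i => congrFun hv (Sum.inr i)
    ext ((j | j) | j) <;> simp [w, hv₁, hv₂, h5, h6]
  · intro hw
    have hw₁ : v₁ ᵥ* A + v₂ ᵥ* Bᵀ = 0 := funext fun j => congrFun hw (Sum.inl (Sum.inl j))
    have hw₂ : v₁ ᵥ* B + v₂ ᵥ* Aᵀ = 0 := funext fun j => congrFun hw (Sum.inl (Sum.inr j))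
    refine ⟨hX _ ?_, by simpa [w] using congrFun hw (Sum.inr 0),
      by simpa [w] using congrFun hw (Sum.inr 1)⟩
    rw [Matrix.vecMul_fromBlocks]
    simp only [Sum.elim_comp_inl, Sum.elim_comp_inr, ← Matrix.vecMul_vecMul,
      ← Matrix.add_vecMul, hw₁, hw₂, Matrix.zero_vecMul]
    exact Sum.elim_zero_zero
end

section
/- There exists a binary self-dual code 𝒞 ⊆ 𝔽₂^{54} of dimension 27 and minimum Hamming distance 10 whose weight enumerator satisfies: the number of codewords of weight 10 is 351 − 8α and the number of codewords of weight 12 is 5031 + 24α, with α = 23 (i.e., A₁₀ = 167 and A₁₂ = 5583). -/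
/-- The Hamming weight of a binary vector. -/
def wt {m : ℕ} (x : Fin m → ZMod 2) : ℕ :=
  (Finset.univ.filter fun i => x i ≠ 0).card

open Matrix

section Weight

theorem wt_eq_sum_val {m : ℕ} (x : Fin m → ZMod 2) : wt x = ∑ i, (x i).val := by
  rw [wt, Finset.card_filter]
  refine Finset.sum_congr rfl fun i _ => ?_
  generalize x i = a
  revert a
  decide

theorem wt_le {m : ℕ} (x : Fin m → ZMod 2) : wt x ≤ m :=
  (Finset.card_le_univ _).trans_eq (Fintype.card_fin m)

@[simp] theorem wt_eq_zero {m : ℕ} {x : Fin m → ZMod 2} : wt x = 0 ↔ x = 0 := by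
  simp [wt, Finset.filter_eq_empty_iff, funext_iff]

theorem wt_append {m n : ℕ} (x : Fin m → ZMod 2) (y : Fin n → ZMod 2) :
    wt (Fin.append x y) = wt x + wt y := by
  simp [wt_eq_sum_val, Fin.sum_univ_add]

theorem wt_cons {m : ℕ} (a : ZMod 2) (x : Fin m → ZMod 2) :
    wt (Fin.cons a x : Fin (m + 1) → ZMod 2) = a.val + wt x := by
  simp [wt_eq_sum_val, Fin.sum_univ_succ]

end Weight

section Lanes

/-- A binary vector written as a natural number with one base-`64` digit per coordinate. Addition
of vectors becomes bitwise exclusive or, and the weight is the residue modulo `63`. -/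
def lanes {m : ℕ} (x : Fin m → ZMod 2) : ℕ :=
  ∑ i, (x i).val * 64 ^ (i : ℕ)

theorem lanes_succ {m : ℕ} (x : Fin (m + 1) → ZMod 2) :
    lanes x = (x 0).val + 64 * lanes (fun i => x i.succ) := by
  simp only [lanes, Fin.sum_univ_succ, Finset.mul_sum, Fin.val_zero, pow_zero, mul_one,
    Fin.val_succ, pow_succ]
  congr 1
  exact Finset.sum_congr rfl fun i _ => by ring

theorem xor_add_sixtyFour_mul {a b : ℕ} (ha : a < 64) (hb : b < 64) (c d : ℕ) :
    (a + 64 * c) ^^^ (b + 64 * d) = (a ^^^ b) + 64 * (c ^^^ d) := by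
  have hab : a ^^^ b < 64 := Nat.xor_lt_two_pow (n := 6) ha hb
  have hdiv := Nat.xor_div_two_pow (a := a + 64 * c) (b := b + 64 * d) (n := 6)
  have hmod := Nat.xor_mod_two_pow (a := a + 64 * c) (b := b + 64 * d) (n := 6)
  rw [show 2 ^ 6 = 64 from rfl] at hdiv hmod
  rw [show (a + 64 * c) / 64 = c by omega, show (b + 64 * d) / 64 = d by omega] at hdiv
  rw [show (a + 64 * c) % 64 = a by omega, show (b + 64 * d) % 64 = b by omega] at hmod
  omega

theorem lanes_add {m : ℕ} (x y : Fin m → ZMod 2) : lanes (x + y) = lanes x ^^^ lanes y := by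
  induction m with
  | zero => simp [lanes]
  | succ m ih =>
    have hlt : ∀ a : ZMod 2, a.val < 64 := by decide
    have hval : ∀ a b : ZMod 2, (a + b).val = a.val ^^^ b.val := by decide
    rw [lanes_succ, lanes_succ x, lanes_succ y, xor_add_sixtyFour_mul (hlt _) (hlt _), ← ih,
      Pi.add_apply, hval]
    rfl

@[simp] theorem lanes_zero {m : ℕ} : lanes (0 : Fin m → ZMod 2) = 0 := by
  simp [lanes]

theorem lanes_mod {m : ℕ} (hm : m < 63) (x : Fin m → ZMod 2) : lanes x % 63 = wt x := by
  have h : lanes x ≡ wt x [MOD 63] := by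
    rw [wt_eq_sum_val, lanes]
    refine Nat.ModEq.sum fun i _ => ?_
    simpa using (Nat.ModEq.refl (x i).val).mul
      ((show 64 ≡ 1 [MOD 63] from rfl).pow (i : ℕ))
  exact Eq.trans h (Nat.mod_eq_of_lt ((wt_le x).trans_lt hm))

end Lanes

section Counting

/-- The number of ways to choose at most `k` entries of `gs` such that the residue modulo `63` of
the exclusive or of `x` with the chosen entries satisfies `p`. -/
def countLe (p : ℕ → Bool) (k : ℕ) : List ℕ → ℕ → ℕ :=
  Nat.rec (fun _ x => cond (p (Nat.mod x 63)) 1 0)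
    (fun _ c gs x =>
      List.rec (cond (p (Nat.mod x 63)) 1 0)
        (fun g t s => Nat.add s (c t (Nat.xor x g))) gs) k

theorem countLe_zero (p : ℕ → Bool) (gs : List ℕ) (x : ℕ) :
    countLe p 0 gs x = if p (x % 63) then 1 else 0 :=
  Bool.cond_eq_ite _ _ _

theorem countLe_nil (p : ℕ → Bool) (k x : ℕ) :
    countLe p k [] x = if p (x % 63) then 1 else 0 := by
  cases k <;> exact Bool.cond_eq_ite _ _ _

theorem countLe_succ_cons (p : ℕ → Bool) (k g : ℕ) (t : List ℕ) (x : ℕ) :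
    countLe p (k + 1) (g :: t) x = countLe p (k + 1) t x + countLe p k t (x ^^^ g) :=
  rfl

theorem countLe_drop_of_eq {p : ℕ → Bool} {k : ℕ} {gs : List ℕ} {i x a b : ℕ} (hi : i < gs.length)
    (ha : countLe p k (gs.drop (i + 1)) (x ^^^ gs[i]) = a)
    (hb : countLe p (k + 1) (gs.drop (i + 1)) x = b) :
    countLe p (k + 1) (gs.drop i) x = a + b := by
  rw [List.drop_eq_getElem_cons hi, countLe_succ_cons, ha, hb, add_comm]

theorem sum_fin_succ_pi_zmod_two {n : ℕ} (f : (Fin (n + 1) → ZMod 2) → ℕ) :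
    ∑ l, f l = ∑ l, f (Fin.cons 0 l) + ∑ l, f (Fin.cons 1 l) := by
  rw [← (Fin.consEquiv fun _ => ZMod 2).sum_comp, Fintype.sum_prod_type]
  exact Fin.sum_univ_two _

theorem card_filter_wt_le_zero {n : ℕ} (q : (Fin n → ZMod 2) → Prop) [DecidablePred q] :
    (Finset.univ.filter fun l => wt l ≤ 0 ∧ q l).card = if q 0 then 1 else 0 := by
  simp only [Nat.le_zero, wt_eq_zero, ← Finset.filter_filter, Finset.filter_eq',
    Finset.mem_univ, if_true, Finset.filter_singleton]
  split_ifs <;> rfl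

theorem countLe_ofFn_lanes (p : ℕ → Bool) {m : ℕ} (hm : m < 63) {n : ℕ}
    (v : Fin n → Fin m → ZMod 2) (k : ℕ) (a : Fin m → ZMod 2) :
    countLe p k (List.ofFn fun i => lanes (v i)) (lanes a) =
      (Finset.univ.filter fun l : Fin n → ZMod 2 =>
        wt l ≤ k ∧ p (wt (a + ∑ i, l i • v i))).card := by
  induction n generalizing k a with
  | zero =>
    rw [List.ofFn_zero, countLe_nil, lanes_mod hm, Finset.card_filter, Fintype.sum_unique]
    simp [wt]
  | succ n ih =>
    cases k with
    | zero =>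
      rw [countLe_zero, lanes_mod hm, card_filter_wt_le_zero]
      simp
    | succ k =>
      have h1 : (1 : ZMod 2).val = 1 := rfl
      rw [List.ofFn_succ, countLe_succ_cons, ← lanes_add, ih, ih, Finset.card_filter,
        Finset.card_filter, Finset.card_filter, sum_fin_succ_pi_zmod_two]
      simp [wt_cons, Fin.sum_univ_succ, h1, add_assoc, add_comm 1]

end Counting

section SystematicEncoder

variable {n : ℕ}

/-- The systematic encoder with redundancy matrix `M`, the information digits coming last. -/
def encode (M : Matrix (Fin n) (Fin n) (ZMod 2)) :
    (Fin n → ZMod 2) →ₗ[ZMod 2] (Fin (n + n) → ZMod 2) where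
  toFun l := Fin.append (l ᵥ* M) l
  map_add' x y := by
    ext i
    refine Fin.addCases (fun i => ?_) (fun i => ?_) i <;> simp [add_vecMul, -Fin.natAdd_eq_addNat]
  map_smul' c x := by
    ext i
    refine Fin.addCases (fun i => ?_) (fun i => ?_) i <;> simp [smul_vecMul, -Fin.natAdd_eq_addNat]

theorem encode_apply (M : Matrix (Fin n) (Fin n) (ZMod 2)) (l : Fin n → ZMod 2) :
    encode M l = Fin.append (l ᵥ* M) l :=
  rfl

theorem encode_injective (M : Matrix (Fin n) (Fin n) (ZMod 2)) :
    Function.Injective (encode M) := fun x y h => by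
  ext i
  simpa [encode_apply, -Fin.natAdd_eq_addNat] using congrFun h (Fin.natAdd n i)

theorem wt_encode (M : Matrix (Fin n) (Fin n) (ZMod 2)) (l : Fin n → ZMod 2) :
    wt (encode M l) = wt (l ᵥ* M) + wt l :=
  wt_append _ _

theorem sum_append_mul_append (a b c d : Fin n → ZMod 2) :
    ∑ i, Fin.append a b i * Fin.append c d i = a ⬝ᵥ c + b ⬝ᵥ d := by
  simp [Fin.sum_univ_add, dotProduct, -Fin.natAdd_eq_addNat]

theorem mem_range_encode_iff {M : Matrix (Fin n) (Fin n) (ZMod 2)} (hM : M * Mᵀ = 1)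
    (x : Fin (n + n) → ZMod 2) :
    x ∈ LinearMap.range (encode M) ↔
      ∀ y ∈ LinearMap.range (encode M), ∑ i, x i * y i = 0 := by
  constructor
  · rintro ⟨l, rfl⟩ _ ⟨l', rfl⟩
    rw [encode_apply, encode_apply, sum_append_mul_append, ← mulVec_transpose M l',
      dotProduct_mulVec, vecMul_vecMul, hM, vecMul_one, CharTwo.add_self_eq_zero]
  · intro h
    obtain ⟨r, l, rfl⟩ : ∃ r l : Fin n → ZMod 2, x = Fin.append r l :=
      ⟨_, _, (Fin.append_castAdd_natAdd (f := x)).symm⟩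
    have hl : l = M *ᵥ r := by
      ext i
      have hi := h _ ⟨Pi.single i 1, rfl⟩
      rw [encode_apply, sum_append_mul_append, single_one_vecMul, dotProduct_single, mul_one,
        dotProduct_comm, CharTwo.add_eq_zero] at hi
      exact hi.symm
    refine ⟨l, ?_⟩
    rw [encode_apply, hl, ← mulVec_transpose, mulVec_mulVec, mul_eq_one_comm.mp hM, one_mulVec]

theorem finrank_range_encode (M : Matrix (Fin n) (Fin n) (ZMod 2)) :
    Module.finrank (ZMod 2) (LinearMap.range (encode M)) = n := by
  rw [LinearMap.finrank_range_of_inj (encode_injective M), Module.finrank_fin_fun]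

theorem wt_encode_transpose {M : Matrix (Fin n) (Fin n) (ZMod 2)} (hM : M * Mᵀ = 1)
    (l : Fin n → ZMod 2) : wt (encode Mᵀ (l ᵥ* M)) = wt (encode M l) := by
  rw [wt_encode, wt_encode, vecMul_vecMul, hM, vecMul_one, add_comm]

theorem ncard_range_encode_wt_eq {M : Matrix (Fin n) (Fin n) (ZMod 2)} (hM : M * Mᵀ = 1)
    {w k k' : ℕ} (hw : w = k + k' + 1) :
    {x | x ∈ LinearMap.range (encode M) ∧ wt x = w}.ncard =
      (Finset.univ.filter fun l => wt l ≤ k ∧ wt (encode M l) = w).card +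
        (Finset.univ.filter fun l => wt l ≤ k' ∧ wt (encode Mᵀ l) = w).card := by
  have himage : {x | x ∈ LinearMap.range (encode M) ∧ wt x = w} =
      encode M '' (Finset.univ.filter fun l => wt (encode M l) = w : Finset _) := by
    ext x
    constructor
    · rintro ⟨⟨l, rfl⟩, hl⟩
      exact ⟨l, by simpa using hl, rfl⟩
    · rintro ⟨l, hl, rfl⟩
      exact ⟨⟨l, rfl⟩, by simpa using hl⟩
  rw [himage, Set.ncard_image_of_injective _ (encode_injective M), Set.ncard_coe_finset,
    ← Finset.card_filter_add_card_filter_not (fun l => wt l ≤ k), Finset.filter_filter,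
    Finset.filter_filter]
  congr 1
  · simp only [and_comm]
  · have hM' : Mᵀ * M = 1 := mul_eq_one_comm.mp hM
    refine Finset.card_nbij' (· ᵥ* M) (· ᵥ* Mᵀ) ?_ ?_ ?_ ?_
    · intro l hl
      simp only [Finset.coe_filter, Finset.mem_univ, true_and, Set.mem_ofPred_eq] at hl ⊢
      rw [wt_encode_transpose hM]
      refine ⟨?_, hl.1⟩
      have := wt_encode M l
      omega
    · intro l hl
      simp only [Finset.coe_filter, Finset.mem_univ, true_and, Set.mem_ofPred_eq] at hl ⊢
      have h := wt_encode_transpose (M := Mᵀ) (by rwa [transpose_transpose]) l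
      rw [transpose_transpose] at h
      refine ⟨h.trans hl.2, ?_⟩
      have := wt_encode Mᵀ l
      omega
    · intro l _
      simp [vecMul_vecMul, hM]
    · intro l _
      simp [vecMul_vecMul, hM']

theorem countLe_encode (p : ℕ → Bool) (hn : n + n < 63) (M : Matrix (Fin n) (Fin n) (ZMod 2))
    (k : ℕ) :
    countLe p k (List.ofFn fun i => lanes (Fin.append (M i) (Pi.single i 1))) 0 =
      (Finset.univ.filter fun l => wt l ≤ k ∧ p (wt (encode M l))).card := by
  have hrow : ∀ i, Fin.append (M i) (Pi.single i 1) = encode M (Pi.single i 1) := fun i => by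
    rw [encode_apply, single_one_vecMul]
    rfl
  have hsum : ∀ l : Fin n → ZMod 2, ∑ i, l i • encode M (Pi.single i 1) = encode M l := fun l => by
    simp_rw [← map_smul, ← map_sum]
    congr 1
    ext j
    simp [Finset.sum_apply, Pi.single_apply]
  simp only [hrow]
  rw [← lanes_zero, countLe_ofFn_lanes p hn]
  simp only [zero_add, hsum]

theorem eq_zero_of_countLe_eq_one (hn : n + n < 63)
    {M : Matrix (Fin n) (Fin n) (ZMod 2)} {k d : ℕ}
    (h : countLe (fun w => Nat.ble w d) k
      (List.ofFn fun i => lanes (Fin.append (M i) (Pi.single i 1))) 0 = 1)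
    {l : Fin n → ZMod 2} (hl : wt l ≤ k) (hd : wt (encode M l) ≤ d) : l = 0 := by
  rw [countLe_encode _ hn] at h
  exact Finset.card_le_one.mp h.le _ (by simp [hl, hd]) _
    (by simp [wt_eq_zero.mpr])

theorem ncard_range_encode_wt_eq_of_countLe {M : Matrix (Fin n) (Fin n) (ZMod 2)}
    (hM : M * Mᵀ = 1) (hn : n + n < 63) {w k k' : ℕ} (hw : w = k + k' + 1) {gs gs' : List ℕ}
    (hgs : (List.ofFn fun i => lanes (Fin.append (M i) (Pi.single i 1))) = gs)
    (hgs' : (List.ofFn fun i => lanes (Fin.append (Mᵀ i) (Pi.single i 1))) = gs') {a a' : ℕ}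
    (ha : countLe (fun x => Nat.beq x w) k gs 0 = a)
    (ha' : countLe (fun x => Nat.beq x w) k' gs' 0 = a') :
    {x | x ∈ LinearMap.range (encode M) ∧ wt x = w}.ncard = a + a' := by
  subst hgs hgs' ha ha'
  rw [ncard_range_encode_wt_eq hM hw, countLe_encode _ hn, countLe_encode _ hn]
  simp only [Nat.beq_eq]

end SystematicEncoder

section Code

/-- The binary expansions of the rows of `redundancy`. -/
def redundancyBits : Fin 27 → ℕ :=
  ![58008169, 87154482, 4677980, 9275852, 113544433, 11082042, 106472300, 711985,
   91349466, 132352635, 25399470, 25396565, 127286680, 129187976, 49897744, 128120381,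
   46248779, 77388150, 38154321, 69780602, 118417452, 44210532, 83757473, 83661634,
   4169624, 106930144, 90169344]

/-- The redundancy matrix of a self-dual `[54, 27, 10]` code. -/
def redundancy : Matrix (Fin 27) (Fin 27) (ZMod 2) :=
  Matrix.of fun i j => if (redundancyBits i).testBit j then 1 else 0

/-- The lanes of the rows of the generator matrix `[redundancy | 1]`. -/
def rowLanes : List ℕ :=
  [5847456103292434178377756222878059438823293845505,
   374235785309875926842960693995034229056405860515904,
   23945242826034957930049575718505893465507711255056384,
   1532495540866237307523167854590796043794634499193835520,
   98079714708188340854483524302201976216360282421790244865,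
   6277101735386681112370024511245549925084729306672036839488,
   401734511064840339990962278345478911931433135857392448442368,
   25711008708143844408671393498232860934183121038129144346443777,
   1645504557321206133521127791855004057375268379533836314155941952,
   105312291668557186790711782433488549868130340448746638995991298113,
   6739986666787659948666776420949249931224482736037847589892078702656,
   431359146674410236714672264041508433041009507386330650883053494210561,
   27606985387162255149739116242857323369011953746674015618258856466186240,
   1766847064778384329583297593536667822456958705661767165252689521746903040,
   113078212145816597093331040048974386685747116049801379806918958754216017920,
   7237005577332262213973186563135787990134674288337546569280339637469198946305,
   463168356949264781694283940034753059014666306220299782855216766656165429116993,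
   29642774844752946028434172162224195754637899749885116140990940569391872914493504,
   1897137590064188545819787018382342683695228565986015206452540733294638499203383297,
   121416805764108066932466369176469931756494279859031513384894615683359116313191776320,
   7770675568902916283677847627294075626662420756979665106677027546495906578470269095936,
   497323236409786642155382248146820840100457578393574637724188096727238744896629314162688,
   31828687130226345097944463881396533766429284995236567180138360863196624861452118777659393,
   2037035976334486086268445688409378161051468485010142563900084046331959491781277619928956992,
   130370302485407109521180524058200202307293977194619920127133907341756240924633918051193192448,
   8343699359066055009355553539724812947666814540548445988077386870412191029132774768367655452672,
   533996758980227520598755426542388028650676130589254558645284650116153679560458352335519777554432]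

/-- The lanes of the rows of the generator matrix `[redundancyᵀ | 1]`. -/
def colLanes : List ℕ :=
  [5846006554768129868148774507333207293647896182785,
   374144419505160311561521568464602918324994219966528,
   23945242826029599811673970159096346884385846883258368,
   1532495540888189604906874913977309593851638372555296769,
   98079714615439187680153839138608809768601437088207867968,
   6277101735388108017059433847809034129488434166044932702273,
   401734511064748996481717464462798748480119867723781937303553,
   25711008708143845858225275899819840855899304590976598084419584,
   1645504557321206043604871599194035665269086365240627012571500608,
   105312291668557186699367924570718649944547606137436997218520268865,
   6739986666787659948668203320192832928102158011468818229596554002496,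
   431359146674410236714673690946282912964230147935124925126636271304768,
   27606985387162255149739024899005073928943380931872212097971368023294016,
   1766847064778384329583297592086770850338468879429945391550201494669103105,
   113078212145816597093331040138890637347490404042848956544740424515644821568,
   7237005577332262213973186563135787990136024285599974137284873945750113091648,
   463168356949264781694283940034844424813851024585533434089196617132870541250625,
   29642774844752946028434172162224197203843418078341857151077521528502367945756672,
   1897137590064188545819787018382342775061730094838933254095578633381889054121136129,
   121416805764108066932466369176469931757944182106856243000011200160212452657695293440,
   7770675568902916283677847627294075626662421110873305610745803815277551810210401615937,
   497323236409786642155382248146820840100456173452071668929782046771047591577650628395073,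
   31828687130226345097944463881396533766429286422484173465504337112915885740965798434836481,
   2037035976334486086268445688409378161051468393666290229368335106679152383559174251100766208,
   130370302485407109521180524058200202307293977285963772375223649143433868170590005459282821185,
   8343699359066055009355553539724812947666814540457102130384737384761663032286053838667244371969,
   533996758980227520598755426542388028650676130589255963940681300947854781738173407016420810686528]

theorem redundancy_mul_transpose : redundancy * redundancyᵀ = 1 := by
  decide +kernel

theorem ofFn_lanes_redundancy :
    (List.ofFn fun i => lanes (Fin.append (redundancy i) (Pi.single i 1))) = rowLanes := by
  decide +kernel

theorem ofFn_lanes_redundancy_transpose :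
    (List.ofFn fun i => lanes (Fin.append (redundancyᵀ i) (Pi.single i 1))) = colLanes := by
  decide +kernel

theorem countLe_rowLanes_ble : countLe (fun w => Nat.ble w 9) 4 rowLanes 0 = 1 := by
  decide +kernel

theorem countLe_colLanes_ble : countLe (fun w => Nat.ble w 9) 4 colLanes 0 = 1 := by
  decide +kernel

theorem countLe_rowLanes_ten : countLe (fun w => Nat.beq w 10) 5 rowLanes 0 = 88 := by
  decide +kernel

theorem countLe_colLanes_ten : countLe (fun w => Nat.beq w 10) 4 colLanes 0 = 79 := by
  decide +kernel

theorem countLe_rowLanes_twelve_drop_six :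
    countLe (fun w => Nat.beq w 12) 6 (rowLanes.drop 6) 0 = 904 := by
  decide +kernel

theorem countLe_rowLanes_twelve_drop_five :
    countLe (fun w => Nat.beq w 12) 6 (rowLanes.drop 5) 0 = 1171 :=
  countLe_drop_of_eq (i := 5) (k := 5) (a := 267) (b := 904) (by decide) (by decide +kernel)
    countLe_rowLanes_twelve_drop_six

theorem countLe_rowLanes_twelve_drop_four :
    countLe (fun w => Nat.beq w 12) 6 (rowLanes.drop 4) 0 = 1497 :=
  countLe_drop_of_eq (i := 4) (k := 5) (a := 326) (b := 1171) (by decide) (by decide +kernel)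
    countLe_rowLanes_twelve_drop_five

theorem countLe_rowLanes_twelve_drop_three :
    countLe (fun w => Nat.beq w 12) 6 (rowLanes.drop 3) 0 = 1886 :=
  countLe_drop_of_eq (i := 3) (k := 5) (a := 389) (b := 1497) (by decide) (by decide +kernel)
    countLe_rowLanes_twelve_drop_four

theorem countLe_rowLanes_twelve_drop_two :
    countLe (fun w => Nat.beq w 12) 6 (rowLanes.drop 2) 0 = 2383 :=
  countLe_drop_of_eq (i := 2) (k := 5) (a := 497) (b := 1886) (by decide) (by decide +kernel)
    countLe_rowLanes_twelve_drop_three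

theorem countLe_rowLanes_twelve_drop_one :
    countLe (fun w => Nat.beq w 12) 6 (rowLanes.drop 1) 0 = 2965 :=
  countLe_drop_of_eq (i := 1) (k := 5) (a := 582) (b := 2383) (by decide) (by decide +kernel)
    countLe_rowLanes_twelve_drop_two

theorem countLe_rowLanes_twelve :
    countLe (fun w => Nat.beq w 12) 6 rowLanes 0 = 3657 :=
  countLe_drop_of_eq (i := 0) (k := 5) (a := 692) (b := 2965) (by decide) (by decide +kernel)
    countLe_rowLanes_twelve_drop_one

theorem countLe_colLanes_twelve : countLe (fun w => Nat.beq w 12) 5 colLanes 0 = 1926 := by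
  decide +kernel

theorem ncard_wt_ten : {x | x ∈ LinearMap.range (encode redundancy) ∧ wt x = 10}.ncard = 167 :=
  ncard_range_encode_wt_eq_of_countLe (w := 10) (k := 5) (k' := 4) (a := 88) (a' := 79)
    redundancy_mul_transpose (by norm_num) rfl ofFn_lanes_redundancy ofFn_lanes_redundancy_transpose
    countLe_rowLanes_ten countLe_colLanes_ten

theorem ncard_wt_twelve :
    {x | x ∈ LinearMap.range (encode redundancy) ∧ wt x = 12}.ncard = 5583 :=
  ncard_range_encode_wt_eq_of_countLe (w := 12) (k := 6) (k' := 5) (a := 3657) (a' := 1926)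
    redundancy_mul_transpose (by norm_num) rfl ofFn_lanes_redundancy ofFn_lanes_redundancy_transpose
    countLe_rowLanes_twelve countLe_colLanes_twelve

theorem ten_le_wt_encode {l : Fin 27 → ZMod 2} (hl : l ≠ 0) : 10 ≤ wt (encode redundancy l) := by
  by_contra! hlt
  have hrow := countLe_rowLanes_ble
  have hcol := countLe_colLanes_ble
  rw [← ofFn_lanes_redundancy] at hrow
  rw [← ofFn_lanes_redundancy_transpose] at hcol
  have hwt := wt_encode redundancy l
  rcases le_or_gt (wt l) 4 with h | h
  · exact hl (eq_zero_of_countLe_eq_one (by norm_num) hrow h (by omega))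
  · have hzero := eq_zero_of_countLe_eq_one (by norm_num) hcol
      (show wt (l ᵥ* redundancy) ≤ 4 by omega)
      (by rw [wt_encode_transpose redundancy_mul_transpose]; omega)
    apply hl
    rw [← vecMul_one l, ← redundancy_mul_transpose, ← vecMul_vecMul, hzero, zero_vecMul]

end Code

/-- There exists a binary self-dual `[54, 27, 10]` code with `A₁₀ = 351 - 8·23 = 167`
and `A₁₂ = 5031 + 24·23 = 5583` (weight enumerator `W₅₄,₁` with `α = 23`). -/
theorem exists_self_dual_54_27_10 :
    ∃ C : Submodule (ZMod 2) (Fin 54 → ZMod 2),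
      (∀ x, x ∈ C ↔ ∀ y ∈ C, ∑ i, x i * y i = 0) ∧
      Module.finrank (ZMod 2) C = 27 ∧
      (∀ x ∈ C, x ≠ 0 → 10 ≤ wt x) ∧
      (∃ x ∈ C, x ≠ 0 ∧ wt x = 10) ∧
      {x | x ∈ C ∧ wt x = 10}.ncard = 351 - 8 * 23 ∧
      {x | x ∈ C ∧ wt x = 12}.ncard = 5031 + 24 * 23 := by
  refine ⟨LinearMap.range (encode redundancy), mem_range_encode_iff redundancy_mul_transpose,
    finrank_range_encode redundancy, ?_, ?_, ncard_wt_ten, ncard_wt_twelve⟩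
  · rintro _ ⟨l, rfl⟩ hx
    exact ten_le_wt_encode fun hl => hx (by rw [hl, map_zero])
  · obtain ⟨x, hx, hwt⟩ := Set.nonempty_of_ncard_ne_zero
      (ncard_wt_ten.trans_ne (by norm_num : 167 ≠ 0))
    refine ⟨x, hx, ?_, hwt⟩
    rintro rfl
    rw [wt_eq_zero.mpr rfl] at hwt
    exact absurd hwt (by norm_num)
end
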